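/- Let f_BSM : [0,1] → [0,1] be defined by f_BSM(z) = 2z for 0 ≤ z < 1/2 and f_BSM(z) = 2z − 1 for 1/2 ≤ z ≤ 1. Let m_r ≥ 1 be an integer and let u ∈ {0,1}^ℕ contain no run of more than m_r consecutive equal bits (no index i with u_i = u_{i+1} = ⋯ = u_{i+m_r}). Let ū denote the bitwise complement of u (ū_k = 1 − u_k), and set z⁰ = Σ_{k=1}^∞ u_k 2^{−k}, z¹ = Σ_{k=1}^∞ ū_k 2^{−k}. Then for every integer j ≥ 1, ( f_BSM^{(j)}(z⁰) − f_BSM^{(j)}(z¹) )² ≥ 4^{−(m_r+1)}, and consequently for every integer d ≥ 1, Σ_{j=1}^{d} ( f_BSM^{(j)}(z⁰) − f_BSM^{(j)}(z¹) )² ≥ d · 4^{−(m_r+1)}. -/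

import Mathlib

/-- The Bernoulli shift map on `[0,1]`: `z ↦ 2z` for `z < 1/2`, `z ↦ 2z − 1` otherwise. -/
noncomputable def fBSM : ℝ → ℝ := fun z => if z < 1 / 2 then 2 * z else 2 * z - 1

/-- The real number in `[0, 1]` with binary digits `v 0, v 1, …` after the binary point. -/
noncomputable def binaryValue (v : ℕ → ℕ) : ℝ := ∑' k : ℕ, (v k : ℝ) * (2:ℝ)⁻¹ ^ (k + 1)

theorem summable_two_inv_pow_succ : Summable fun k : ℕ => (2:ℝ)⁻¹ ^ (k + 1) :=
  (summable_nat_add_iff 1).2 (summable_geometric_of_lt_one (by norm_num) (by norm_num))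

theorem tsum_two_inv_pow_succ : ∑' k : ℕ, (2:ℝ)⁻¹ ^ (k + 1) = 1 := by
  simp_rw [pow_succ, tsum_mul_right]
  rw [tsum_geometric_of_lt_one (by norm_num) (by norm_num)]
  norm_num

theorem summable_binary {v : ℕ → ℕ} (hv : ∀ k, v k ≤ 1) :
    Summable fun k : ℕ => (v k : ℝ) * (2:ℝ)⁻¹ ^ (k + 1) := by
  refine Summable.of_nonneg_of_le (fun k => by positivity) (fun k => ?_) summable_two_inv_pow_succ
  exact mul_le_of_le_one_left (by positivity) (by exact_mod_cast hv k)

theorem binaryValue_nonneg (v : ℕ → ℕ) : 0 ≤ binaryValue v :=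
  tsum_nonneg fun _ => by positivity

theorem binaryValue_eq_head_add_tail {v : ℕ → ℕ} (hv : ∀ k, v k ≤ 1) :
    binaryValue v = (v 0 : ℝ) / 2 + binaryValue (fun k => v (k + 1)) / 2 := by
  have h : ∀ k : ℕ, (v (k + 1) : ℝ) * (2:ℝ)⁻¹ ^ (k + 1 + 1) =
      (v (k + 1) : ℝ) * (2:ℝ)⁻¹ ^ (k + 1) / 2 := fun k => by ring
  unfold binaryValue
  rw [(summable_binary hv).tsum_eq_zero_add]
  simp_rw [h, tsum_div_const]
  ring

theorem binaryValue_add_compl {v : ℕ → ℕ} (hv : ∀ k, v k ≤ 1) :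
    binaryValue v + binaryValue (fun k => 1 - v k) = 1 := by
  unfold binaryValue
  rw [← (summable_binary hv).tsum_add (summable_binary fun k => Nat.sub_le 1 (v k)),
    ← tsum_two_inv_pow_succ]
  refine tsum_congr fun k => ?_
  rw [Nat.cast_sub (hv k)]
  push_cast
  ring

theorem two_inv_pow_le_binaryValue {v : ℕ → ℕ} (hv : ∀ k, v k ≤ 1) {k n : ℕ} (hk : v k = 1)
    (hkn : k ≤ n) : (2:ℝ)⁻¹ ^ (n + 1) ≤ binaryValue v := by
  calc (2:ℝ)⁻¹ ^ (n + 1) ≤ (2:ℝ)⁻¹ ^ (k + 1) :=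
        pow_le_pow_of_le_one (by norm_num) (by norm_num) (by omega)
    _ = (v k : ℝ) * (2:ℝ)⁻¹ ^ (k + 1) := by simp [hk]
    _ ≤ binaryValue v := (summable_binary hv).le_tsum k fun _ _ => by positivity

theorem binaryValue_le_one_sub {v : ℕ → ℕ} (hv : ∀ k, v k ≤ 1) {k n : ℕ} (hk : v k = 0)
    (hkn : k ≤ n) : binaryValue v ≤ 1 - (2:ℝ)⁻¹ ^ (n + 1) := by
  have h := two_inv_pow_le_binaryValue (v := fun k => 1 - v k) (fun k => Nat.sub_le 1 (v k))
    (by simp [hk]) hkn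
  linarith [binaryValue_add_compl hv]

theorem fBSM_binaryValue {v : ℕ → ℕ} (hv : ∀ k, v k ≤ 1) (h : ∃ k, v (k + 1) = 0) :
    fBSM (binaryValue v) = binaryValue (fun k => v (k + 1)) := by
  obtain ⟨k, hk⟩ := h
  have hlt := binaryValue_le_one_sub (v := fun k => v (k + 1)) (fun k => hv _) hk le_rfl
  have hpos : (0:ℝ) < (2:ℝ)⁻¹ ^ (k + 1) := by positivity
  have hnn := binaryValue_nonneg (fun k => v (k + 1))
  have hsplit := binaryValue_eq_head_add_tail hv
  unfold fBSM
  rcases Nat.le_one_iff_eq_zero_or_eq_one.1 (hv 0) with h0 | h0 <;> rw [h0] at hsplit <;>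
    push_cast at hsplit
  · rw [if_pos (by linarith)]
    linarith
  · rw [if_neg (by linarith)]
    linarith

theorem fBSM_iterate_binaryValue {v : ℕ → ℕ} (hv : ∀ k, v k ≤ 1)
    (h : ∀ i, ∃ k, v (i + k + 1) = 0) (j : ℕ) :
    fBSM^[j] (binaryValue v) = binaryValue (fun k => v (j + k)) := by
  induction j with
  | zero => simp
  | succ j ih =>
    rw [Function.iterate_succ_apply', ih, fBSM_binaryValue (v := fun k => v (j + k)) (fun k => hv _) (h j)]
    congr 1
    funext k
    congr 1
    omega

/-- If both bits occur among the digits `1, …, n + 1`, the value is bounded away from `1 / 2`. -/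
theorem four_inv_pow_le_sq_binaryValue_sub_compl {v : ℕ → ℕ} (hv : ∀ k, v k ≤ 1) {n : ℕ}
    (h0 : ∃ k ≤ n, v (k + 1) = 0) (h1 : ∃ k ≤ n, v (k + 1) = 1) :
    (4:ℝ)⁻¹ ^ (n + 1) ≤ (binaryValue v - binaryValue (fun k => 1 - v k)) ^ 2 := by
  obtain ⟨k, hkn, hk⟩ := h0
  obtain ⟨l, hln, hl⟩ := h1
  have hub := binaryValue_le_one_sub (v := fun k => v (k + 1)) (fun k => hv _) hk hkn
  have hlb := two_inv_pow_le_binaryValue (v := fun k => v (k + 1)) (fun k => hv _) hl hln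
  have hsplit := binaryValue_eq_head_add_tail hv
  have hcompl := binaryValue_add_compl hv
  have hpow : (4:ℝ)⁻¹ ^ (n + 1) = ((2:ℝ)⁻¹ ^ (n + 1)) ^ 2 := by
    rw [← pow_mul, mul_comm, pow_mul]
    norm_num
  have hpos : (0:ℝ) ≤ (2:ℝ)⁻¹ ^ (n + 1) := by positivity
  rw [hpow, sq_le_sq, abs_of_nonneg hpos, le_abs]
  rcases Nat.le_one_iff_eq_zero_or_eq_one.1 (hv 0) with h | h <;> rw [h] at hsplit <;>
    push_cast at hsplit
  · right
    linarith
  · left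
    linarith

/-- Anytime-reliability proposition for adaptive-bandwidth CCM with the BSM
(conjugation `g(x) = x`): for complementary initial conditions whose symbolic
sequence has no run of more than `mr` equal bits, every pair of iterates is at
squared distance at least `4^{−(mr+1)}`, so the squared Euclidean distance of the
trajectories after `d` steps is at least `d · 4^{−(mr+1)}`. -/
theorem stmt5 (mr : ℕ) (hmr : 1 ≤ mr) (u : ℕ → ℕ) (hu : ∀ k, u k = 0 ∨ u k = 1)
    (hrun : ¬ ∃ i : ℕ, 1 ≤ i ∧ ∀ t ≤ mr, u (i + t) = u i)
    (z0 z1 : ℝ)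
    (hz0 : z0 = ∑' k : ℕ, (u (k + 1) : ℝ) * (2:ℝ)⁻¹ ^ (k + 1))
    (hz1 : z1 = ∑' k : ℕ, ((1 - u (k + 1) : ℕ) : ℝ) * (2:ℝ)⁻¹ ^ (k + 1)) :
    (∀ j : ℕ, 1 ≤ j → (4:ℝ)⁻¹ ^ (mr + 1) ≤ (fBSM^[j] z0 - fBSM^[j] z1) ^ 2) ∧
    (∀ d : ℕ, 1 ≤ d →
      (d : ℝ) * (4:ℝ)⁻¹ ^ (mr + 1) ≤
        ∑ j ∈ Finset.Icc 1 d, (fBSM^[j] z0 - fBSM^[j] z1) ^ 2) := by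
  have hle : ∀ k, u k ≤ 1 := fun k => by have := hu k; omega
  have hbits : ∀ i, (∃ k ≤ mr, u (i + k + 1) = 0) ∧ ∃ k ≤ mr, u (i + k + 1) = 1 := by
    intro i
    push Not at hrun
    obtain ⟨t, ht, hne⟩ := hrun (i + 1) (by omega)
    rw [show i + 1 + t = i + t + 1 by omega] at hne
    rcases hu (i + 1) with h | h <;> rcases hu (i + t + 1) with h' | h'
    · omega
    · exact ⟨⟨0, by omega, h⟩, t, ht, h'⟩
    · exact ⟨⟨t, ht, h'⟩, 0, by omega, h⟩
    · omega
  have hz0' : z0 = binaryValue fun k => u (k + 1) := hz0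
  have hz1' : z1 = binaryValue fun k => 1 - u (k + 1) := hz1
  have key : ∀ j : ℕ, (4:ℝ)⁻¹ ^ (mr + 1) ≤ (fBSM^[j] z0 - fBSM^[j] z1) ^ 2 := by
    intro j
    rw [hz0', hz1', fBSM_iterate_binaryValue (fun k => hle _) (fun i => ?_),
      fBSM_iterate_binaryValue (fun k => Nat.sub_le _ _) (fun i => ?_)]
    · refine four_inv_pow_le_sq_binaryValue_sub_compl (v := fun k => u (j + k + 1))
        (fun k => hle _) ?_ ?_
      · obtain ⟨k, hk, h⟩ := (hbits (j + 1)).1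
        exact ⟨k, hk, by rw [← h]; congr 1; omega⟩
      · obtain ⟨k, hk, h⟩ := (hbits (j + 1)).2
        exact ⟨k, hk, by rw [← h]; congr 1; omega⟩
    · obtain ⟨k, -, h⟩ := (hbits (i + 1)).2
      exact ⟨k, by rw [show i + k + 1 + 1 = i + 1 + k + 1 by omega, h]⟩
    · obtain ⟨k, -, h⟩ := (hbits (i + 1)).1
      exact ⟨k, by rw [show i + k + 1 + 1 = i + 1 + k + 1 by omega, h]⟩
  refine ⟨fun j _ => key j, fun d _ => ?_⟩
  simpa using Finset.card_nsmul_le_sum (Finset.Icc 1 d)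
    (fun j => (fBSM^[j] z0 - fBSM^[j] z1) ^ 2) _ fun j _ => key j
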